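/- arXiv:2605.31253 — 2 statements merged into one kernel-verified Lean document; each statement's English description precedes it below -/
import Mathlib

section
/- For any instance with exactly 2 agents whose true valuations are additive, and any bid profile (b_1, b_2) in which agent i's bid b_i is a best response to the other agent's bid, the allocation produced by Priority-E-C-E on (b_1, b_2) is EF1 from agent i's perspective with respect to agent i's true valuation. -/
/-!
Formalization of the strategic Envy-Cycle-Elimination (E-C-E) setting.

There are `n` agents and `m` goods (`Fin m`), with the predefined ordering of agents
and goods given by the orders on `Fin n` and `Fin m`.  A bid consists of a reported
additive valuation (a nonnegative value for every good) together with a preference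
list (a permutation of the goods).  E-C-E starts from empty bundles and, while
unallocated goods remain, selects a source of the envy graph (according to the rule of
the respective variant), adds one unallocated good to that agent's bundle (again
according to the rule of the respective variant), and then repeatedly eliminates envy
cycles, in a fixed order, until the envy graph has a source.
-/

open scoped Classical
open Finset

/-- A bid of an agent: a reported additive valuation (a nonnegative value for every
good) together with a preference list, a permutation of the goods. -/
structure Bid (m : ℕ) where
  val : Fin m → ℝ
  nonneg : ∀ g, 0 ≤ val g
  pref : Equiv.Perm (Fin m)

namespace ECE

variable {n m : ℕ}

/-- Reported (additive) value of a bundle. -/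
noncomputable def bval (b : Bid m) (S : Finset (Fin m)) : ℝ := ∑ g ∈ S, b.val g

/-- (True, additive) value of a bundle under the valuation `v`. -/
noncomputable def value (v : Fin m → ℝ) (S : Finset (Fin m)) : ℝ := ∑ g ∈ S, v g

/-- Envy-graph edge: agent `i` envies agent `j` (w.r.t. the reported valuations) under
the partial allocation `P`. -/
def envies (b : Fin n → Bid m) (P : Fin n → Finset (Fin m)) (i j : Fin n) : Prop :=
  bval (b i) (P i) < bval (b i) (P j)

/-- The sources (vertices of in-degree 0) of the envy graph. -/
noncomputable def sources (b : Fin n → Bid m) (P : Fin n → Finset (Fin m)) :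
    Finset (Fin n) :=
  univ.filter fun i => ∀ j, ¬ envies b P j i

/-- The envy cycles of the current envy graph, represented as cyclic permutations `σ`
of the agents such that every agent moved by `σ` envies her image under `σ`. -/
noncomputable def cycleSet (b : Fin n → Bid m) (P : Fin n → Finset (Fin m)) :
    Finset (Equiv.Perm (Fin n)) :=
  univ.filter fun σ => σ.IsCycle ∧ ∀ i, σ i ≠ i → envies b P i (σ i)

/-- A fixed enumeration of the permutations of the agents, providing the fixed
(lexicographic) order in which envy cycles are eliminated. -/
noncomputable def permIdx (n : ℕ) :
    Equiv.Perm (Fin n) ≃ Fin (Fintype.card (Equiv.Perm (Fin n))) :=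
  Fintype.equivFin _

/-- Eliminate one envy cycle (the first one in the fixed order): every agent on the
cycle receives the bundle of the agent she envies. -/
noncomputable def elimOnce (b : Fin n → Bid m) (P : Fin n → Finset (Fin m)) :
    Fin n → Finset (Fin m) :=
  if h : (cycleSet b P).Nonempty then
    let σ := (permIdx n).symm (((cycleSet b P).image (permIdx n)).min' (h.image _))
    fun i => P (σ i)
  else P

/-- Repeatedly eliminate envy cycles until the envy graph has a source. -/
noncomputable def resolve (b : Fin n → Bid m) :
    ℕ → (Fin n → Finset (Fin m)) → Fin n → Finset (Fin m)
  | 0, P => P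
  | fuel + 1, P => if (sources b P).Nonempty then P else resolve b fuel (elimOnce b P)

/-- The state (current partial allocation, remaining unallocated goods) of an E-C-E
run after a given number of steps.  In each step, if unallocated goods remain, the
agent chosen by `pickAgent` (a source of the envy graph) receives the good chosen by
`pickItem`, and afterwards envy cycles are eliminated until the graph has a source. -/
noncomputable def stateECE (b : Fin n → Bid m)
    (pickAgent : (Fin n → Finset (Fin m)) → Option (Fin n))
    (pickItem : Fin n → (R : Finset (Fin m)) → R.Nonempty → Fin m) :
    ℕ → (Fin n → Finset (Fin m)) × Finset (Fin m)
  | 0 => (fun _ => ∅, univ)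
  | k + 1 =>
    let s := stateECE b pickAgent pickItem k
    if hR : s.2.Nonempty then
      match pickAgent s.1 with
      | none => s
      | some i =>
        let g := pickItem i s.2 hR
        (resolve b (n * n + 1) (fun j => if j = i then insert g (s.1 j) else s.1 j),
          s.2.erase g)
    else s

/-- Source selection of Standard-E-C-E: among multiple sources, the agent earliest in
the predefined ordering of the agents. -/
noncomputable def stdAgent (b : Fin n → Bid m) (P : Fin n → Finset (Fin m)) :
    Option (Fin n) :=
  if h : (sources b P).Nonempty then some ((sources b P).min' h) else none

/-- Source selection of the Priority variants: among multiple sources, those having at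
least one outgoing envy edge have priority, ties broken by the predefined ordering of
the agents. -/
noncomputable def priAgent (b : Fin n → Bid m) (P : Fin n → Finset (Fin m)) :
    Option (Fin n) :=
  if h' : ((sources b P).filter fun i => ∃ j, envies b P i j).Nonempty then
    some (((sources b P).filter fun i => ∃ j, envies b P i j).min' h')
  else if h : (sources b P).Nonempty then some ((sources b P).min' h) else none

/-- The unallocated good of highest reported value, ties broken by the predefined
ordering of the goods. -/
noncomputable def bestItem (v : Fin m → ℝ) (R : Finset (Fin m)) (hR : R.Nonempty) :
    Fin m :=
  (R.filter fun g => ∀ g' ∈ R, v g' ≤ v g).min' (by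
    obtain ⟨g, hg, hmax⟩ := R.exists_max_image v hR
    exact ⟨g, mem_filter.2 ⟨hg, hmax⟩⟩)

/-- The earliest unallocated good in the preference list `pref`. -/
noncomputable def preferredItem (pref : Equiv.Perm (Fin m)) (R : Finset (Fin m))
    (hR : R.Nonempty) : Fin m :=
  pref.symm ((R.image pref).min' (hR.image _))

/-- Standard-E-C-E: sources chosen by the predefined agent ordering, goods assigned in
the predefined ordering of the goods. -/
noncomputable def Standard (b : Fin n → Bid m) : Fin n → Finset (Fin m) :=
  (stateECE b (stdAgent b) (fun _ R hR => R.min' hR) m).1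

/-- Priority-E-C-E: envious sources have priority (ties broken by the agent ordering),
goods assigned in the predefined ordering of the goods. -/
noncomputable def Priority (b : Fin n → Bid m) : Fin n → Finset (Fin m) :=
  (stateECE b (priAgent b) (fun _ R hR => R.min' hR) m).1

/-- Best-Item-E-C-E: envious sources have priority, and the chosen agent receives her
unallocated good of highest reported value (ties broken by the good ordering). -/
noncomputable def BestItemECE (b : Fin n → Bid m) : Fin n → Finset (Fin m) :=
  (stateECE b (priAgent b) (fun i R hR => bestItem (b i).val R hR) m).1

/-- Preferred-Item-E-C-E: envious sources have priority, and the chosen agent receives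
the earliest unallocated good in her preference list. -/
noncomputable def PreferredItemECE (b : Fin n → Bid m) : Fin n → Finset (Fin m) :=
  (stateECE b (priAgent b) (fun i R hR => preferredItem (b i).pref R hR) m).1

/-- The allocation `A` is `α`-EF1 from agent `i`'s perspective w.r.t. the valuation
`v`: for every agent `j` with nonempty bundle there is a good `g ∈ A j` with
`v (A i) ≥ α · v (A j \ {g})`. -/
def EF1From (α : ℝ) (v : Fin m → ℝ) (A : Fin n → Finset (Fin m)) (i : Fin n) : Prop :=
  ∀ j : Fin n, (A j).Nonempty → ∃ g ∈ A j, α * value v ((A j).erase g) ≤ value v (A i)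

/-- The allocation `A` is EF1 w.r.t. the valuations `v`. -/
def IsEF1 (v : Fin n → Fin m → ℝ) (A : Fin n → Finset (Fin m)) : Prop :=
  ∀ i : Fin n, EF1From 1 (v i) A i

/-- Agent `i`'s bid in the profile `b` is a best response to the others' bids, w.r.t.
her true (additive) valuation `v`: no alternative bid gives her a bundle of strictly
larger true value. -/
def BestResponse (Mech : (Fin n → Bid m) → Fin n → Finset (Fin m))
    (v : Fin m → ℝ) (b : Fin n → Bid m) (i : Fin n) : Prop :=
  ∀ b' : Bid m, value v (Mech (Function.update b i b') i) ≤ value v (Mech b i)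

/-- The bid profile `b` is a pure Nash equilibrium of the mechanism `Mech` w.r.t. the
true (additive) valuations `v`. -/
def IsPNE (Mech : (Fin n → Bid m) → Fin n → Finset (Fin m))
    (v : Fin n → Fin m → ℝ) (b : Fin n → Bid m) : Prop :=
  ∀ i : Fin n, BestResponse Mech (v i) b i

end ECE

open ECE

namespace ECE

variable {m : ℕ}

/-- The bundles after the selected agent `r` receives the good `g`. -/
noncomputable def award (P : Fin 2 → Finset (Fin m)) (r : Fin 2) (g : Fin m) :
    Fin 2 → Finset (Fin m) :=
  fun x => if x = r then insert g (P x) else P x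

/-- Both agents envy each other. -/
def MutualEnvy (b : Fin 2 → Bid m) (P : Fin 2 → Finset (Fin m)) : Prop :=
  envies b P 0 1 ∧ envies b P 1 0

/-- Explicit form of envy-cycle resolution for two agents. -/
noncomputable def settle (b : Fin 2 → Bid m) (P : Fin 2 → Finset (Fin m)) :
    Fin 2 → Finset (Fin m) :=
  if MutualEnvy b P then fun x => P (Equiv.swap 0 1 x) else P

/-- The agent selected by Priority-E-C-E with two agents, absent mutual envy. -/
noncomputable def recipient (b : Fin 2 → Bid m) (P : Fin 2 → Finset (Fin m)) : Fin 2 :=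
  if envies b P 1 0 then 1 else 0

theorem not_envies_self (b : Fin 2 → Bid m) (P : Fin 2 → Finset (Fin m)) (i : Fin 2) :
    ¬ envies b P i i :=
  lt_irrefl _

theorem sources_nonempty {b : Fin 2 → Bid m} {P : Fin 2 → Finset (Fin m)} :
    (sources b P).Nonempty ↔ ¬ MutualEnvy b P := by
  have h0 := not_envies_self b P 0
  have h1 := not_envies_self b P 1
  simp only [sources, Finset.Nonempty, mem_filter, mem_univ, true_and, Fin.exists_fin_two,
    Fin.forall_fin_two, MutualEnvy]
  tauto

theorem cycleSet_eq {b : Fin 2 → Bid m} {P : Fin 2 → Finset (Fin m)} (h : MutualEnvy b P) :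
    cycleSet b P = {Equiv.swap 0 1} := by
  ext σ
  have hσ : σ = 1 ∨ σ = Equiv.swap 0 1 := by revert σ; decide
  simp only [cycleSet, mem_filter, mem_univ, true_and, mem_singleton]
  constructor
  · rintro ⟨hc, -⟩
    exact hσ.resolve_left hc.ne_one
  · rintro rfl
    refine ⟨Equiv.Perm.isCycle_swap (by decide), ?_⟩
    rw [Fin.forall_fin_two]
    simpa [MutualEnvy] using h

theorem elimOnce_eq {b : Fin 2 → Bid m} {P : Fin 2 → Finset (Fin m)} (h : MutualEnvy b P) :
    elimOnce b P = fun x => P (Equiv.swap 0 1 x) := by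
  simp [elimOnce, cycleSet_eq h]

theorem not_mutualEnvy_settle (b : Fin 2 → Bid m) (P : Fin 2 → Finset (Fin m)) :
    ¬ MutualEnvy b (settle b P) := by
  by_cases h : MutualEnvy b P
  · simp only [settle, if_pos h]
    intro h'
    have h1 := h.1
    have h2 := h'.1
    simp only [envies, Equiv.swap_apply_left, Equiv.swap_apply_right] at h1 h2
    exact lt_asymm h1 h2
  · rwa [settle, if_neg h]

theorem resolve_eq_self {b : Fin 2 → Bid m} {P : Fin 2 → Finset (Fin m)}
    (h : ¬ MutualEnvy b P) (fuel : ℕ) : resolve b fuel P = P := by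
  cases fuel with
  | zero => rfl
  | succ f => simp [resolve, sources_nonempty, h]

theorem resolve_eq_settle (b : Fin 2 → Bid m) (P : Fin 2 → Finset (Fin m)) (fuel : ℕ) :
    resolve b (fuel + 1) P = settle b P := by
  by_cases h : MutualEnvy b P
  · have h' := not_mutualEnvy_settle b P
    simp only [settle, if_pos h] at h' ⊢
    rw [resolve, if_neg (by rwa [sources_nonempty, not_not]), elimOnce_eq h,
      resolve_eq_self h']
  · rw [resolve_eq_self h, settle, if_neg h]

theorem exists_priAgent_eq (b : Fin 2 → Bid m) (P : Fin 2 → Finset (Fin m)) :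
    ∃ F : Finset (Fin 2), (∀ x, x ∈ F ↔ x ∈ sources b P ∧ ∃ j, envies b P x j) ∧
      priAgent b P = if h' : F.Nonempty then some (F.min' h')
        else if h : (sources b P).Nonempty then some ((sources b P).min' h) else none :=
  ⟨_, fun _ => mem_filter, rfl⟩

theorem priAgent_eq {b : Fin 2 → Bid m} {P : Fin 2 → Finset (Fin m)}
    (h : ¬ MutualEnvy b P) : priAgent b P = some (recipient b P) := by
  have h0 := not_envies_self b P 0
  have h1 := not_envies_self b P 1
  unfold MutualEnvy at h
  have hmem : ∀ x, x ∈ sources b P ↔ ∀ j, ¬ envies b P j x := by simp [sources]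
  obtain ⟨F, hF, hpri⟩ := exists_priAgent_eq b P
  rw [hpri, recipient]
  by_cases h10 : envies b P 1 0
  · have : F = {1} := by
      ext x
      revert x
      simp only [hF, hmem, mem_singleton, Fin.forall_fin_two, Fin.exists_fin_two]
      simp_all
    simp [this, h10]
  · by_cases h01 : envies b P 0 1
    · have : F = {0} := by
        ext x
        revert x
        simp only [hF, hmem, mem_singleton, Fin.forall_fin_two, Fin.exists_fin_two]
        simp_all
      simp [this, h10]
    · have hempty : F = ∅ := by
        ext x
        revert x
        simp only [hF, hmem, Fin.forall_fin_two, Fin.exists_fin_two]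
        simp_all
      have hs : sources b P = univ := by
        ext x
        revert x
        simp only [hmem, mem_univ, Fin.forall_fin_two]
        simp_all
      have hmin : ((univ : Finset (Fin 2)).min' univ_nonempty) = 0 :=
        le_antisymm (Finset.min'_le _ _ (mem_univ _)) (Fin.zero_le _)
      simp [hempty, hs, h10, hmin]

/-- The partial allocation of Priority-E-C-E after `k` steps. -/
noncomputable def bundles (b : Fin 2 → Bid m) (k : ℕ) : Fin 2 → Finset (Fin m) :=
  (stateECE b (priAgent b) (fun _ R hR => R.min' hR) k).1

theorem bundles_zero (b : Fin 2 → Bid m) (x : Fin 2) : bundles b 0 x = ∅ := rfl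

theorem state_succ (b : Fin 2 → Bid m) {k : ℕ} (hk : k < m)
    (hrem : (stateECE b (priAgent b) (fun _ R hR => R.min' hR) k).2 =
      univ.filter fun g : Fin m => k ≤ g)
    (hmut : ¬ MutualEnvy b (bundles b k)) :
    stateECE b (priAgent b) (fun _ R hR => R.min' hR) (k + 1) =
      (settle b (award (bundles b k) (recipient b (bundles b k)) ⟨k, hk⟩),
        univ.filter fun g : Fin m => k + 1 ≤ g) := by
  have hmem : (⟨k, hk⟩ : Fin m) ∈
      (stateECE b (priAgent b) (fun _ R hR => R.min' hR) k).2 := by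
    simp [hrem]
  have hne : Finset.Nonempty _ := ⟨_, hmem⟩
  have hmin : (stateECE b (priAgent b) (fun _ R hR => R.min' hR) k).2.min' hne = ⟨k, hk⟩ := by
    refine le_antisymm (Finset.min'_le _ _ hmem) (Finset.le_min' _ _ _ fun g hg => ?_)
    rw [hrem] at hg
    exact Fin.le_def.2 (by simpa using hg)
  have hpri := priAgent_eq hmut
  unfold bundles at hpri
  rw [stateECE]
  simp only [dif_pos hne, hpri, hmin, resolve_eq_settle]
  refine Prod.ext rfl ?_
  ext g
  simp only [hrem, mem_erase, mem_filter, mem_univ, true_and, ne_eq, Fin.ext_iff]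
  omega

theorem state_invariant (b : Fin 2 → Bid m) {k : ℕ} (hk : k ≤ m) :
    (stateECE b (priAgent b) (fun _ R hR => R.min' hR) k).2 =
      (univ.filter fun g : Fin m => k ≤ g) ∧ ¬ MutualEnvy b (bundles b k) := by
  induction k with
  | zero => simp [stateECE, MutualEnvy, envies, bundles]
  | succ k ih =>
    obtain ⟨hrem, hmut⟩ := ih (by omega)
    have h := state_succ b (by omega) hrem hmut
    refine ⟨by rw [h], ?_⟩
    rw [bundles, h]
    exact not_mutualEnvy_settle b _

theorem not_mutualEnvy_bundles (b : Fin 2 → Bid m) {k : ℕ} (hk : k ≤ m) :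
    ¬ MutualEnvy b (bundles b k) :=
  (state_invariant b hk).2

theorem bundles_succ (b : Fin 2 → Bid m) {k : ℕ} (hk : k < m) :
    bundles b (k + 1) =
      settle b (award (bundles b k) (recipient b (bundles b k)) ⟨k, hk⟩) := by
  obtain ⟨hrem, hmut⟩ := state_invariant b hk.le
  rw [bundles, state_succ b hk hrem hmut]

theorem Priority_eq_bundles (b : Fin 2 → Bid m) : Priority b = bundles b m := rfl

theorem settle_eq_or (b : Fin 2 → Bid m) (P : Fin 2 → Finset (Fin m)) :
    settle b P = P ∨ settle b P = fun x => P (Equiv.swap 0 1 x) := by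
  unfold settle
  split_ifs
  · exact Or.inr rfl
  · exact Or.inl rfl

theorem exists_settle_apply (b : Fin 2 → Bid m) (P : Fin 2 → Finset (Fin m)) (x : Fin 2) :
    ∃ c, settle b P x = P c := by
  rcases settle_eq_or b P with h | h <;> rw [h]
  exacts [⟨x, rfl⟩, ⟨_, rfl⟩]

theorem lt_of_mem_bundles (b : Fin 2 → Bid m) {k : ℕ} (hk : k ≤ m) (x : Fin 2)
    {g : Fin m} (hg : g ∈ bundles b k x) : (g : ℕ) < k := by
  induction k generalizing x with
  | zero => simp [bundles_zero] at hg
  | succ k ih =>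
    rw [bundles_succ b (by omega)] at hg
    obtain ⟨c, hc⟩ := exists_settle_apply b
      (award (bundles b k) (recipient b (bundles b k)) ⟨k, by omega⟩) x
    rw [hc, award] at hg
    split_ifs at hg
    · rcases mem_insert.1 hg with rfl | hg
      · simp
      · exact (ih (by omega) _ hg).trans (by omega)
    · exact (ih (by omega) _ hg).trans (by omega)

theorem mem_bundles_iff (b : Fin 2 → Bid m) {k : ℕ} (hk : k ≤ m) {i j : Fin 2} (hij : i ≠ j)
    {g : Fin m} (hg : (g : ℕ) < k) : g ∈ bundles b k i ↔ g ∉ bundles b k j := by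
  have key : ∀ k ≤ m, (g : ℕ) < k → (g ∈ bundles b k 0 ↔ g ∉ bundles b k 1) := by
    intro k hk hg
    induction k with
    | zero => omega
    | succ k ih =>
      rw [bundles_succ b (by omega)]
      have haward : ∀ r, g ∈ award (bundles b k) r ⟨k, by omega⟩ 0 ↔
          g ∉ award (bundles b k) r ⟨k, by omega⟩ 1 := by
        intro r
        rcases Nat.lt_succ_iff_lt_or_eq.1 hg with hlt | heq
        · have hne : g ≠ ⟨k, by omega⟩ := fun h => by simp [h] at hlt
          have := ih (by omega) hlt
          fin_cases r <;> simpa [award, hne] using this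
        · have hnot : ∀ x, g ∉ bundles b k x := fun x hx =>
            absurd (lt_of_mem_bundles b (by omega) x hx) (by omega)
          have heq' : g = ⟨k, by omega⟩ := Fin.ext heq
          fin_cases r <;> simp [award, hnot, ← heq']
      have := haward (recipient b (bundles b k))
      rcases settle_eq_or b
        (award (bundles b k) (recipient b (bundles b k)) ⟨k, by omega⟩) with h | h <;> rw [h]
      · exact this
      · simp only [Equiv.swap_apply_left, Equiv.swap_apply_right]
        tauto
  have := key k hk hg
  fin_cases i <;> fin_cases j <;> simp_all

/-- Bundles, regarded as unlabelled sets, only grow along a run. -/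
theorem exists_bundles_eq_filter (b : Fin 2 → Bid m) {k l : ℕ} (hkl : k ≤ l) (hl : l ≤ m)
    (x : Fin 2) :
    ∃ c, bundles b k c = (bundles b l x).filter fun g : Fin m => (g : ℕ) < k := by
  induction l, hkl using Nat.le_induction generalizing x with
  | base =>
    exact ⟨x, (filter_true_of_mem fun g hg => lt_of_mem_bundles b hl x hg).symm⟩
  | succ l hkl ih =>
    rw [bundles_succ b (by omega)]
    obtain ⟨c, hc⟩ := exists_settle_apply b
      (award (bundles b l) (recipient b (bundles b l)) ⟨l, by omega⟩) x
    obtain ⟨d, hd⟩ := ih (by omega) c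
    refine ⟨d, ?_⟩
    rw [hd, hc, award]
    split_ifs
    · rw [filter_insert, if_neg (by simpa using hkl)]
    · rfl

theorem settle_congr {b b' : Fin 2 → Bid m} {P : Fin 2 → Finset (Fin m)}
    (h : ∀ x y, envies b P x y ↔ envies b' P x y) : settle b P = settle b' P := by
  have hm : MutualEnvy b P ↔ MutualEnvy b' P := by simp only [MutualEnvy, h]
  by_cases h' : MutualEnvy b' P
  · rw [settle, settle, if_pos h', if_pos (hm.2 h')]
  · rw [settle, settle, if_neg h', if_neg (mt hm.1 h')]

theorem recipient_congr {b b' : Fin 2 → Bid m} {P : Fin 2 → Finset (Fin m)}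
    (h : ∀ x y, envies b P x y ↔ envies b' P x y) : recipient b P = recipient b' P := by
  simp only [recipient, h]

theorem envies_congr {b b' : Fin 2 → Bid m} {P : Fin 2 → Finset (Fin m)}
    (h : ∀ x y, ∀ g ∈ P x, (b y).val g = (b' y).val g) (x y : Fin 2) :
    envies b P x y ↔ envies b' P x y := by
  have : ∀ z, bval (b x) (P z) = bval (b' x) (P z) := fun z =>
    Finset.sum_congr rfl (h z x)
  simp only [envies, this]

/-- The first `k` steps depend only on the bids for the first `k` goods. -/
theorem bundles_congr {b b' : Fin 2 → Bid m} {k : ℕ} (hk : k ≤ m)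
    (h : ∀ x, ∀ g : Fin m, (g : ℕ) < k → (b x).val g = (b' x).val g) :
    bundles b k = bundles b' k := by
  induction k with
  | zero => rfl
  | succ k ih =>
    have ih := ih (by omega) fun x g hg => h x g (by omega)
    rw [bundles_succ b (by omega), bundles_succ b' (by omega), ← ih]
    rw [← recipient_congr (envies_congr fun x y g hg =>
      h y g ((lt_of_mem_bundles b (by omega) x hg).trans (by omega)))]
    refine settle_congr (envies_congr fun x y g hg => h y g ?_)
    rw [award] at hg
    split_ifs at hg
    · rcases mem_insert.1 hg with rfl | hg
      · simp
      · exact (lt_of_mem_bundles b (by omega) x hg).trans (by omega)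
    · exact (lt_of_mem_bundles b (by omega) x hg).trans (by omega)

theorem mutualEnvy_iff {b : Fin 2 → Bid m} {P : Fin 2 → Finset (Fin m)} {i j : Fin 2}
    (hij : i ≠ j) : MutualEnvy b P ↔ envies b P i j ∧ envies b P j i := by
  unfold MutualEnvy
  fin_cases i <;> fin_cases j <;> simp_all [and_comm]

theorem recipient_eq_of_envies {b : Fin 2 → Bid m} {P : Fin 2 → Finset (Fin m)} {i j : Fin 2}
    (h : ¬ MutualEnvy b P) (hij : envies b P i j) : recipient b P = i := by
  have h0 := not_envies_self b P 0
  have h1 := not_envies_self b P 1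
  unfold MutualEnvy at h
  unfold recipient
  fin_cases i <;> fin_cases j <;> simp_all

/-- Agent `i` either owns a superset of `S` and does not envy, or envies the agent `j`
who owns exactly `S`. -/
def Targets (b : Fin 2 → Bid m) (S : Finset (Fin m)) (i j : Fin 2)
    (P : Fin 2 → Finset (Fin m)) : Prop :=
  (S ⊆ P i ∧ ¬ envies b P i j) ∨ (P j = S ∧ envies b P i j)

theorem Targets.settle {b : Fin 2 → Bid m} {S : Finset (Fin m)} {i j : Fin 2} (hij : i ≠ j)
    {P : Fin 2 → Finset (Fin m)} (h : Targets b S i j P) :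
    Targets b S i j (settle b P) := by
  by_cases hm : MutualEnvy b P
  · have he := (mutualEnvy_iff hij).1 hm
    rcases h with ⟨-, h⟩ | ⟨hS, -⟩
    · exact absurd he.1 h
    · have hswap : Equiv.swap (0 : Fin 2) 1 i = j ∧ Equiv.swap (0 : Fin 2) 1 j = i := by
        clear he hm hS
        revert i j
        decide
      simp only [ECE.settle, if_pos hm]
      refine Or.inl ⟨?_, ?_⟩
      · simp [hswap, hS]
      · simp only [envies, hswap]
        exact (lt_asymm he.1)
  · simpa [ECE.settle, hm] using h

theorem bval_award_of_val_eq_zero {b : Fin 2 → Bid m} {P : Fin 2 → Finset (Fin m)}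
    {i : Fin 2} {g : Fin m} (hg : (b i).val g = 0) (r x : Fin 2) :
    bval (b i) (award P r g x) = bval (b i) (P x) := by
  unfold award
  split_ifs
  · by_cases hmem : g ∈ P x
    · rw [insert_eq_of_mem hmem]
    · rw [bval, sum_insert hmem, hg, zero_add, bval]
  · rfl

theorem Targets.award {b : Fin 2 → Bid m} {S : Finset (Fin m)} {i j : Fin 2} (hij : i ≠ j)
    {P : Fin 2 → Finset (Fin m)} (h : Targets b S i j P) (hm : ¬ MutualEnvy b P)
    {g : Fin m} (hg : (b i).val g = 0) :
    Targets b S i j (award P (recipient b P) g) := by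
  have he : envies b (ECE.award P (recipient b P) g) i j ↔ envies b P i j := by
    simp only [envies, bval_award_of_val_eq_zero hg]
  unfold Targets
  rw [he]
  rcases h with ⟨hS, h⟩ | ⟨hS, h⟩
  · refine Or.inl ⟨?_, h⟩
    unfold ECE.award
    split_ifs
    · exact hS.trans (subset_insert _ _)
    · exact hS
  · refine Or.inr ⟨?_, h⟩
    rw [recipient_eq_of_envies hm h, ECE.award, if_neg hij.symm, hS]

theorem Targets.bundles {b : Fin 2 → Bid m} {S : Finset (Fin m)} {i j : Fin 2} (hij : i ≠ j)
    {k l : ℕ} (hkl : k ≤ l) (hl : l ≤ m) (hzero : ∀ g : Fin m, k ≤ g → (b i).val g = 0)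
    (h : Targets b S i j (bundles b k)) : Targets b S i j (bundles b l) := by
  induction l, hkl using Nat.le_induction with
  | base => exact h
  | succ l hkl ih =>
    rw [bundles_succ b (by omega)]
    exact ((ih (by omega)).award hij (not_mutualEnvy_bundles b (by omega))
      (hzero _ hkl)).settle hij

/-- The bid that agrees with `b` before `g`, exceeds the total value of `b` at `g`, and
vanishes after `g`. -/
noncomputable def spike (b : Bid m) (g : Fin m) : Bid m where
  val x := if x < g then b.val x else if x = g then 1 + ∑ y, b.val y else 0
  nonneg x := by
    have := Finset.sum_nonneg fun y (_ : y ∈ univ) => b.nonneg y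
    split_ifs
    · exact b.nonneg x
    · linarith
    · exact le_rfl
  pref := b.pref

theorem bval_spike_lt {b : Bid m} {g : Fin m} {S T : Finset (Fin m)} (hS : g ∈ S)
    (hT : ∀ x ∈ T, x < g) : bval (spike b g) T < bval (spike b g) S := by
  have hT' : bval (spike b g) T ≤ ∑ y, b.val y := by
    calc bval (spike b g) T = ∑ y ∈ T, b.val y :=
          sum_congr rfl fun x hx => by simp [spike, hT x hx]
      _ ≤ ∑ y, b.val y :=
          sum_le_sum_of_subset_of_nonneg (subset_univ _) fun y _ _ => b.nonneg y
  have hS' : (spike b g).val g ≤ bval (spike b g) S :=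
    single_le_sum (fun y _ => (spike b g).nonneg y) hS
  have : (spike b g).val g = 1 + ∑ y, b.val y := by simp [spike]
  linarith

/-- If `X` is a bundle right after its last good `g` was allocated, then by bidding
`spike` at `g` agent `i` ends up with a superset of `X`, or the other agent gets just `X`. -/
theorem spike_outcome (b : Fin 2 → Bid m) {i j : Fin 2} (hij : i ≠ j) {g : Fin m}
    {X : Finset (Fin m)} (hg : g ∈ X) {c : Fin 2} (hc : bundles b (g + 1) c = X) :
    X ⊆ Priority (Function.update b i (spike (b i) g)) i ∨
      Priority (Function.update b i (spike (b i) g)) j = X := by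
  set b' := Function.update b i (spike (b i) g) with hb'
  have hbi : b' i = spike (b i) g := by simp [hb']
  have hagree : ∀ x, ∀ y : Fin m, (y : ℕ) < g → (b x).val y = (b' x).val y := by
    intro x y hy
    by_cases hx : x = i
    · subst hx
      rw [hbi]
      simp [spike, show y < g from hy]
    · simp [hb', hx]
  have hprefix : bundles b g = bundles b' g := bundles_congr g.2.le hagree
  have hlt : ∀ x, ∀ y ∈ bundles b g x, (y : ℕ) < g := fun x y hy =>
    lt_of_mem_bundles b g.2.le x hy
  have hrec : recipient b (bundles b g) = recipient b' (bundles b g) :=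
    recipient_congr (envies_congr fun x y z hz => hagree y z (hlt x z hz))
  set r := recipient b (bundles b g) with hr
  have hX : award (bundles b g) r g r = X := by
    rw [bundles_succ b g.2] at hc
    obtain ⟨d, hd⟩ := exists_settle_apply b (award (bundles b g) r g) c
    have hd' : award (bundles b g) r g d = X := hd.symm.trans hc
    by_cases hdr : d = r
    · rwa [hdr] at hd'
    · rw [award, if_neg hdr] at hd'
      exact absurd (hlt d g (hd' ▸ hg)) (lt_irrefl _)
  have hother : ∀ d ≠ r, ∀ y ∈ award (bundles b g) r g d, y < g := by
    intro d hd y hy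
    rw [award, if_neg hd] at hy
    exact hlt d y hy
  have hstart : Targets b' X i j (award (bundles b g) r g) := by
    by_cases hri : i = r
    · refine Or.inl ⟨by rw [hri, hX], ?_⟩
      unfold envies
      rw [hbi]
      refine (bval_spike_lt ?_ (hother j (hri ▸ hij.symm))).not_gt
      rw [hri, hX]
      exact hg
    · have hrj : j = r := by omega
      refine Or.inr ⟨by rw [hrj, hX], ?_⟩
      unfold envies
      rw [hbi]
      refine bval_spike_lt ?_ (hother i hri)
      rw [hrj, hX]
      exact hg
  have hnext : Targets b' X i j (bundles b' (g + 1)) := by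
    rw [bundles_succ b' g.2, ← hprefix, ← hrec]
    exact hstart.settle hij
  have hzero : ∀ y : Fin m, (g : ℕ) + 1 ≤ y → (b' i).val y = 0 := by
    intro y hy
    have h1 : ¬ y < g := fun h => by rw [Fin.lt_def] at h; omega
    have h2 : y ≠ g := fun h => by rw [h] at hy; omega
    rw [hbi]
    simp [spike, h1, h2]
  rw [Priority_eq_bundles]
  exact (hnext.bundles hij g.2 le_rfl hzero).imp And.left And.left

theorem mem_Priority_iff (b : Fin 2 → Bid m) {i j : Fin 2} (hij : i ≠ j) (g : Fin m) :
    g ∈ Priority b i ↔ g ∉ Priority b j :=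
  mem_bundles_iff b le_rfl hij g.2

/-- A bid of agent `i` that secures the other agent's bundle without its last good `z`, or
that adds `z` to her own bundle. -/
theorem exists_deviation (b : Fin 2 → Bid m) {i j : Fin 2} (hij : i ≠ j) {z : Fin m}
    (hz : z ∈ Priority b j) (hmax : ∀ g ∈ Priority b j, g ≤ z)
    (hne : ((Priority b j).erase z).Nonempty) :
    ∃ b' : Bid m, (Priority b j).erase z ⊆ Priority (Function.update b i b') i ∨
      Priority (Function.update b i b') j = (Priority b j).erase z := by
  set X := (Priority b j).erase z with hXdef
  have hgX := X.max'_mem hne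
  set g := X.max' hne
  obtain ⟨c, hc⟩ := exists_bundles_eq_filter b (k := g + 1) g.2 le_rfl j
  have hgz : g < z := lt_of_le_of_ne (hmax _ (mem_of_mem_erase hgX)) (ne_of_mem_erase hgX)
  refine ⟨spike (b i) g, spike_outcome b hij hgX (hc.trans ?_)⟩
  ext y
  rw [mem_filter, hXdef, mem_erase, ← Priority_eq_bundles]
  constructor
  · rintro ⟨hy, hlt⟩
    refine ⟨?_, hy⟩
    rintro rfl
    rw [Fin.lt_def] at hgz
    omega
  · rintro ⟨hyz, hy⟩
    have : y ≤ g := X.le_max' y (mem_erase.2 ⟨hyz, hy⟩)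
    rw [Fin.le_def] at this
    exact ⟨hy, by omega⟩

theorem value_mono {v : Fin m → ℝ} (hv : ∀ g, 0 ≤ v g) {S T : Finset (Fin m)} (h : S ⊆ T) :
    value v S ≤ value v T :=
  sum_le_sum_of_subset_of_nonneg h fun g _ _ => hv g

theorem exists_value_erase_le {v : Fin m → ℝ} (hv : ∀ g, 0 ≤ v g) {i j : Fin 2} (hij : i ≠ j)
    (b : Fin 2 → Bid m) (hbr : BestResponse Priority v b i) (hne : (Priority b j).Nonempty) :
    ∃ g ∈ Priority b j, value v ((Priority b j).erase g) ≤ value v (Priority b i) := by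
  induction hN : (Priority b j).card generalizing b with
  | zero => exact absurd (card_eq_zero.1 hN) hne.ne_empty
  | succ N ih =>
    have hz := (Priority b j).max'_mem hne
    have hmax := (Priority b j).le_max'
    set z := (Priority b j).max' hne
    by_cases hne' : ((Priority b j).erase z).Nonempty
    · obtain ⟨b', h | h⟩ := exists_deviation b hij hz hmax hne'
      · exact ⟨z, hz, (value_mono hv h).trans (hbr b')⟩
      · have hi : Priority (Function.update b i b') i = insert z (Priority b i) := by
          ext y
          rw [mem_Priority_iff _ hij, h, mem_insert, mem_Priority_iff b hij, mem_erase]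
          tauto
        have hval : value v (Priority (Function.update b i b') i) =
            v z + value v (Priority b i) := by
          rw [hi]
          exact sum_insert fun hzi => (mem_Priority_iff b hij z).1 hzi hz
        have hdev := hbr b'
        have hvz : v z = 0 := le_antisymm (by linarith) (hv z)
        obtain ⟨x, hx, hle⟩ := ih (Function.update b i b')
          (fun b'' => by
            rw [Function.update_idem]
            linarith [hbr b''])
          (h ▸ hne') (by rw [h, card_erase_of_mem hz, hN, Nat.add_sub_cancel])
        rw [h] at hx hle
        have hzx : z ∈ (Priority b j).erase x := mem_erase.2 ⟨(ne_of_mem_erase hx).symm, hz⟩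
        have hsum : value v (((Priority b j).erase x).erase z) + v z =
            value v ((Priority b j).erase x) := sum_erase_add _ _ hzx
        rw [erase_right_comm] at hle
        exact ⟨x, mem_of_mem_erase hx, by linarith⟩
    · refine ⟨z, hz, ?_⟩
      rw [not_nonempty_iff_eq_empty.1 hne']
      exact value_mono hv (empty_subset _)

end ECE

open ECE

/-- For any instance with exactly 2 agents whose true valuations are
additive, and any bid profile in which agent `i`'s bid is a best response to the other
agent's bid, the allocation produced by Priority-E-C-E is EF1 from agent `i`'s
perspective with respect to agent `i`'s true valuation. -/
theorem priority_two_best_response_EF1 {m : ℕ} (v : Fin 2 → Fin m → ℝ)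
    (hv : ∀ i g, 0 ≤ v i g) (b : Fin 2 → Bid m) (i : Fin 2)
    (hbr : BestResponse Priority (v i) b i) :
    EF1From 1 (v i) (Priority b) i := by
  intro j hne
  simp only [one_mul]
  by_cases hij : i = j
  · subst hij
    obtain ⟨g, hg⟩ := hne
    exact ⟨g, hg, value_mono (hv i) (erase_subset _ _)⟩
  · exact exists_value_erase_le (hv i) hij b hbr hne
end

section
/- For any instance with exactly 2 agents whose true valuations are additive, and any bid profile (b_1, b_2) in which agent i's bid b_i is a best response to the other agent's bid, the allocation produced by Preferred-Item-E-C-E on (b_1, b_2) is EF1 from agent i's perspective with respect to agent i's true valuation. -/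
/-!
Formalization of the strategic Envy-Cycle-Elimination (E-C-E) setting.

There are `n` agents and `m` goods (`Fin m`), with the predefined ordering of agents
and goods given by the orders on `Fin n` and `Fin m`.  A bid consists of a reported
additive valuation (a nonnegative value for every good) together with a preference
list (a permutation of the goods).  E-C-E starts from empty bundles and, while
unallocated goods remain, selects a source of the envy graph (according to the rule of
the respective variant), adds one unallocated good to that agent's bundle (again
according to the rule of the respective variant), and then repeatedly eliminates envy
cycles, in a fixed order, until the envy graph has a source.
-/

open scoped Classical
open Finset

open ECE

namespace ECE

variable {m : ℕ}

theorem mem_sources_two {b : Fin 2 → Bid m} {P : Fin 2 → Finset (Fin m)} {i j : Fin 2}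
    (hij : i ≠ j) : i ∈ sources b P ↔ ¬ envies b P j i := by
  simp only [sources, mem_filter, mem_univ, true_and]
  refine ⟨fun h => h j, fun h l => ?_⟩
  have hl : l = i ∨ l = j := by omega
  rcases hl with rfl | rfl
  · simp [envies]
  · exact h

theorem priAgent_two {b : Fin 2 → Bid m} {P : Fin 2 → Finset (Fin m)} {i j : Fin 2}
    (hij : i ≠ j) (hj : ¬ envies b P j i) (hi : envies b P i j ∨ i = 0) :
    priAgent b P = some i := by
  have hirr : ∀ l, ¬ envies b P l l := fun l => by simp [envies]
  have hmem : i ∈ sources b P := (mem_sources_two hij).2 hj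
  by_cases he : envies b P i j
  · have hfil : ((sources b P).filter fun i => ∃ j, envies b P i j) = {i} := by
      ext l
      have hl : l = i ∨ l = j := by omega
      rcases hl with rfl | rfl
      · simpa [hmem, -Fin.exists_fin_two] using ⟨_, he⟩
      · simp [mem_sources_two hij.symm, he, hij.symm]
    simp only [priAgent, hfil, singleton_nonempty, dif_pos, min'_singleton]
  · have hi0 : i = 0 := hi.resolve_left he
    have hfil : ((sources b P).filter fun i => ∃ j, envies b P i j) = ∅ := by
      refine filter_eq_empty_iff.2 fun l _ => ?_
      rintro ⟨l', hl'⟩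
      have hl : l = i ∨ l = j := by omega
      have hl2 : l' = i ∨ l' = j := by omega
      rcases hl with rfl | rfl <;> rcases hl2 with rfl | rfl
      exacts [hirr _ hl', he hl', hj hl', hirr _ hl']
    have hne : (sources b P).Nonempty := ⟨i, hmem⟩
    have hmin : (sources b P).min' hne = i :=
      le_antisymm (min'_le _ _ hmem) (hi0 ▸ Fin.zero_le _)
    simp only [priAgent, hfil, Finset.not_nonempty_empty, hne, hmin, ↓reduceDIte]

theorem resolve_of_not_mutual {b : Fin 2 → Bid m} {P : Fin 2 → Finset (Fin m)} {i j : Fin 2}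
    (hij : i ≠ j) (h : ¬ (envies b P i j ∧ envies b P j i)) (k : ℕ) :
    resolve b k P = P := by
  cases k with
  | zero => rfl
  | succ k =>
    have hne : (sources b P).Nonempty := by
      by_cases h' : envies b P j i
      · exact ⟨j, (mem_sources_two hij.symm).2 fun h'' => h ⟨h'', h'⟩⟩
      · exact ⟨i, (mem_sources_two hij).2 h'⟩
    simp [resolve, hne]

theorem elimOnce_of_mutual {b : Fin 2 → Bid m} {P : Fin 2 → Finset (Fin m)} {i j : Fin 2}
    (hij : i ≠ j) (h₁ : envies b P i j) (h₂ : envies b P j i) :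
    elimOnce b P = fun l => P (Equiv.swap i j l) := by
  have hcyc : cycleSet b P = {Equiv.swap i j} := by
    ext σ
    simp only [cycleSet, mem_filter, mem_univ, true_and, mem_singleton]
    constructor
    · rintro ⟨hσ, -⟩
      have h01 : σ i = j := by
        by_contra hne
        have hii : σ i = i := by omega
        have hjj : σ j = j := by
          have : σ j ≠ σ i := fun h => hij (σ.injective h).symm
          omega
        refine hσ.ne_one (Equiv.ext fun l => ?_)
        have hl : l = i ∨ l = j := by omega
        rcases hl with rfl | rfl
        exacts [hii, hjj]
      have h10 : σ j = i := by
        have : σ j ≠ σ i := fun h => hij (σ.injective h).symm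
        omega
      refine Equiv.ext fun l => ?_
      have hl : l = i ∨ l = j := by omega
      rcases hl with rfl | rfl <;> simp [h01, h10]
    · rintro rfl
      refine ⟨Equiv.Perm.isCycle_swap hij, fun l _ => ?_⟩
      have hl : l = i ∨ l = j := by omega
      rcases hl with rfl | rfl <;> simpa
  simp [elimOnce, hcyc]

theorem resolve_of_mutual {b : Fin 2 → Bid m} {P : Fin 2 → Finset (Fin m)} {i j : Fin 2}
    (hij : i ≠ j) (h₁ : envies b P i j) (h₂ : envies b P j i) (k : ℕ) :
    resolve b (k + 1) P = fun l => P (Equiv.swap i j l) := by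
  have hne : ¬ (sources b P).Nonempty := by
    rintro ⟨l, hl⟩
    have hl' : l = i ∨ l = j := by omega
    rcases hl' with rfl | rfl
    · exact (mem_sources_two hij).1 hl h₂
    · exact (mem_sources_two hij.symm).1 hl h₁
  rw [resolve, if_neg hne, elimOnce_of_mutual hij h₁ h₂]
  refine resolve_of_not_mutual hij (fun h => ?_) k
  have := h.1
  simp only [envies, Equiv.swap_apply_left, Equiv.swap_apply_right] at this h₁
  exact lt_asymm this h₁

theorem preferredItem_eq {p : Equiv.Perm (Fin m)} {R : Finset (Fin m)} (hR : R.Nonempty)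
    {g : Fin m} (hg : g ∈ R) (hmin : ∀ x ∈ R, p g ≤ p x) : preferredItem p R hR = g := by
  rw [preferredItem, Equiv.symm_apply_eq]
  refine le_antisymm (min'_le _ _ (mem_image_of_mem _ hg)) (le_min' _ _ _ fun y hy => ?_)
  obtain ⟨x, hx, rfl⟩ := mem_image.1 hy
  exact hmin x hx

/-- After `k` steps of Preferred-Item-E-C-E, agents `i` and `j` hold `A` and `B`, and the goods
in `R` are unallocated. -/
def StateAt (b : Fin 2 → Bid m) (i j : Fin 2) (k : ℕ) (A B R : Finset (Fin m)) : Prop :=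
  let s := stateECE b (priAgent b) (fun i R hR => preferredItem (b i).pref R hR) k
  s.1 i = A ∧ s.1 j = B ∧ s.2 = R

theorem StateAt.comm {b : Fin 2 → Bid m} {i j : Fin 2} {k : ℕ} {A B R : Finset (Fin m)}
    (h : StateAt b i j k A B R) : StateAt b j i k B A R :=
  ⟨h.2.1, h.1, h.2.2⟩

theorem StateAt.zero (b : Fin 2 → Bid m) (i j : Fin 2) : StateAt b i j 0 ∅ ∅ univ :=
  ⟨rfl, rfl, rfl⟩

section Step

variable {b : Fin 2 → Bid m} {i j : Fin 2} {k : ℕ} {A B R : Finset (Fin m)} {g : Fin m}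

theorem StateAt.succ_eq (h : StateAt b i j k A B R) (hij : i ≠ j) (hg : g ∈ R)
    (hmin : ∀ x ∈ R, (b i).pref g ≤ (b i).pref x)
    (hj : ¬ bval (b j) B < bval (b j) A) (hi : bval (b i) A < bval (b i) B ∨ i = 0) :
    stateECE b (priAgent b) (fun i R hR => preferredItem (b i).pref R hR) (k + 1) =
      (resolve b (2 * 2 + 1) (fun l => if l = i then insert g A else B), R.erase g) := by
  obtain ⟨hA, hB, hR⟩ := h
  have hne : (stateECE b (priAgent b)
      (fun i R hR => preferredItem (b i).pref R hR) k).2.Nonempty := hR ▸ ⟨g, hg⟩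
  have hp := priAgent_two (b := b) (P := (stateECE b (priAgent b)
    (fun i R hR => preferredItem (b i).pref R hR) k).1) hij
    (by simpa [envies, hA, hB] using hj) (by simpa [envies, hA, hB] using hi)
  have hgood : ∀ h : R.Nonempty, preferredItem (b i).pref R h = g := fun h =>
    preferredItem_eq h hg hmin
  rw [stateECE]
  dsimp only
  rw [dif_pos hne]
  simp only [hp, hgood, hR]
  congr 2
  funext l
  have hl : l = i ∨ l = j := by omega
  rcases hl with rfl | rfl
  · simp [hA]
  · simp [hij.symm, hB]

theorem StateAt.succ (h : StateAt b i j k A B R) (hij : i ≠ j) (hg : g ∈ R)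
    (hmin : ∀ x ∈ R, (b i).pref g ≤ (b i).pref x)
    (hj : ¬ bval (b j) B < bval (b j) A) (hi : bval (b i) A < bval (b i) B ∨ i = 0)
    (hmut : ¬ (bval (b i) (insert g A) < bval (b i) B ∧
      bval (b j) B < bval (b j) (insert g A))) :
    StateAt b i j (k + 1) (insert g A) B (R.erase g) := by
  unfold StateAt
  rw [h.succ_eq hij hg hmin hj hi,
    resolve_of_not_mutual hij (by simpa [envies, hij.symm] using hmut)]
  simp [hij.symm]

theorem StateAt.succ_swap (h : StateAt b i j k A B R) (hij : i ≠ j) (hg : g ∈ R)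
    (hmin : ∀ x ∈ R, (b i).pref g ≤ (b i).pref x)
    (hj : ¬ bval (b j) B < bval (b j) A) (hi : bval (b i) A < bval (b i) B ∨ i = 0)
    (h₁ : bval (b i) (insert g A) < bval (b i) B)
    (h₂ : bval (b j) B < bval (b j) (insert g A)) :
    StateAt b i j (k + 1) B (insert g A) (R.erase g) := by
  unfold StateAt
  rw [h.succ_eq hij hg hmin hj hi, resolve_of_mutual hij (by simpa [envies, hij.symm] using h₁)
    (by simpa [envies, hij.symm] using h₂)]
  simp [hij.symm]

end Step

theorem exists_greedy_split (u : Fin m → ℝ) (p : Equiv.Perm (Fin m)) (c : ℝ)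
    (R : Finset (Fin m)) : ∃ Y ⊆ R,
      (∀ y ∈ Y, c + ∑ a ∈ Y with p a < p y, u a ≤ ∑ a ∈ R \ Y with p a < p y, u a) ∧
      ∀ x ∈ R \ Y, ∑ a ∈ R \ Y with p a < p x, u a < c + ∑ a ∈ Y with p a < p x, u a := by
  induction R using Finset.induction_on_max_value p with
  | empty => exact ⟨∅, by simp⟩
  | insert a S ha hmax ih =>
    obtain ⟨Y, hY, h₁, h₂⟩ := ih
    have haY : a ∉ Y := fun h => ha (hY h)
    have hlt : ∀ x ∈ S, p x < p a := fun x hx =>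
      lt_of_le_of_ne (hmax x hx) fun h => ha (p.injective h ▸ hx)
    have hfil : ∀ Z : Finset (Fin m), ∀ x ∈ insert a S,
        (insert a Z).filter (fun z => p z < p x) = Z.filter (fun z => p z < p x) := by
      intro Z x hx
      rw [filter_insert, if_neg]
      rcases mem_insert.1 hx with rfl | hx
      · exact lt_irrefl _
      · exact (hlt x hx).not_gt
    have hall : ∀ Z ⊆ S, Z.filter (fun z => p z < p a) = Z := fun Z hZ =>
      filter_true_of_mem fun z hz => hlt z (hZ hz)
    by_cases hc : c + ∑ z ∈ Y, u z ≤ ∑ z ∈ S \ Y, u z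
    · refine ⟨insert a Y, insert_subset_insert _ hY, ?_, ?_⟩
      · rw [insert_sdiff_insert, sdiff_insert_of_notMem ha]
        intro y hy
        rw [hfil _ _ (insert_subset_insert _ hY hy)]
        rcases mem_insert.1 hy with rfl | hy
        · rwa [hall Y hY, hall _ sdiff_subset]
        · exact h₁ y hy
      · rw [insert_sdiff_insert, sdiff_insert_of_notMem ha]
        intro x hx
        rw [hfil _ _ (mem_insert_of_mem (mem_sdiff.1 hx).1)]
        exact h₂ x hx
    · refine ⟨Y, hY.trans (subset_insert _ _), ?_, ?_⟩
      · rw [insert_sdiff_of_notMem _ haY]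
        intro y hy
        rw [hfil _ _ (mem_insert_of_mem (hY hy))]
        exact h₁ y hy
      · rw [insert_sdiff_of_notMem _ haY]
        intro x hx
        rw [hfil _ _ (insert_subset_insert _ sdiff_subset hx)]
        rcases mem_insert.1 hx with rfl | hx
        · rw [hall Y hY, hall _ sdiff_subset]
          exact not_le.1 hc
        · exact h₂ x hx

theorem exists_perm_lt_of_key_lt (f : Fin m → ℕ) :
    ∃ σ : Equiv.Perm (Fin m), ∀ a b, f a < f b → σ a < σ b := by
  refine ⟨(Tuple.sort f).symm, fun a b hab => ?_⟩
  by_contra! h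
  have := Tuple.monotone_sort f h
  simp only [Function.comp_apply, Equiv.apply_symm_apply] at this
  exact this.not_gt hab

/-- After `k` steps two agents hold `A` and `B`, and the goods in `R` are unallocated. -/
structure IsPartial (k : ℕ) (A B R : Finset (Fin m)) : Prop where
  disjoint_left : Disjoint A R
  disjoint_right : Disjoint B R
  card : k + #R = m
  sum : ∀ u : Fin m → ℝ, ∑ a ∈ A, u a + ∑ a ∈ B, u a + ∑ a ∈ R, u a = ∑ a, u a

namespace IsPartial

variable {k : ℕ} {A B R : Finset (Fin m)} {g : Fin m}

theorem zero : IsPartial 0 (∅ : Finset (Fin m)) ∅ univ := by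
  constructor <;> simp

theorem comm (h : IsPartial k A B R) : IsPartial k B A R :=
  ⟨h.disjoint_right, h.disjoint_left, h.card, fun u => by rw [← h.sum u]; ring⟩

theorem notMem_left (h : IsPartial k A B R) (hg : g ∈ R) : g ∉ A := fun hA =>
  Finset.disjoint_left.1 h.disjoint_left hA hg

theorem sum_insert_left (h : IsPartial k A B R) (hg : g ∈ R) (u : Fin m → ℝ) :
    ∑ a ∈ insert g A, u a = ∑ a ∈ A, u a + u g := by
  rw [sum_insert (h.notMem_left hg), add_comm]

theorem sum_insert_right (h : IsPartial k A B R) (hg : g ∈ R) (u : Fin m → ℝ) :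
    ∑ a ∈ insert g B, u a = ∑ a ∈ B, u a + u g :=
  h.comm.sum_insert_left hg u

theorem insert_left (h : IsPartial k A B R) (hg : g ∈ R) :
    IsPartial (k + 1) (insert g A) B (R.erase g) where
  disjoint_left := by
    rw [disjoint_insert_left]
    exact ⟨notMem_erase _ _, h.disjoint_left.mono_right (erase_subset _ _)⟩
  disjoint_right := h.disjoint_right.mono_right (erase_subset _ _)
  card := by
    have := card_erase_add_one hg
    have := h.card
    omega
  sum u := by
    rw [h.sum_insert_left hg, ← h.sum u, ← sum_erase_add R u hg]
    ring

theorem insert_right (h : IsPartial k A B R) (hg : g ∈ R) :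
    IsPartial (k + 1) A (insert g B) (R.erase g) :=
  (h.comm.insert_left hg).comm

theorem sum_update_left (h : IsPartial k A B R) (hg : g ∈ R) (w : Fin m → ℝ) (c : ℝ) :
    ∑ a ∈ A, Function.update w g c a = ∑ a ∈ A, w a :=
  sum_update_of_notMem (h.notMem_left hg) _ _

theorem sum_update_right (h : IsPartial k A B R) (hg : g ∈ R) (w : Fin m → ℝ) (c : ℝ) :
    ∑ a ∈ B, Function.update w g c a = ∑ a ∈ B, w a :=
  h.comm.sum_update_left hg w c

theorem sum_insert_update_left (h : IsPartial k A B R) (hg : g ∈ R) (w : Fin m → ℝ) (c : ℝ) :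
    ∑ a ∈ insert g A, Function.update w g c a = ∑ a ∈ A, w a + c := by
  rw [h.sum_insert_left hg, h.sum_update_left hg, Function.update_self]

theorem sum_insert_update_right (h : IsPartial k A B R) (hg : g ∈ R) (w : Fin m → ℝ) (c : ℝ) :
    ∑ a ∈ insert g B, Function.update w g c a = ∑ a ∈ B, w a + c :=
  h.comm.sum_insert_update_left hg w c

end IsPartial

theorem StateAt.preferredItemECE_eq {b : Fin 2 → Bid m} {i j : Fin 2} {k : ℕ}
    {A B R : Finset (Fin m)} (h : StateAt b i j k A B R) (hp : IsPartial k A B R)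
    (hR : R = ∅) : PreferredItemECE b i = A ∧ PreferredItemECE b j = B := by
  obtain rfl : k = m := by simpa [hR] using hp.card
  exact ⟨h.1, h.2.1⟩

/-- Every bid of agent `i` whose preference list satisfies `C` and whose valuation agrees with `w`
outside `R` leads, after `k` steps, to the state `(A, B, R)`. -/
def Forces (b : Fin 2 → Bid m) (i j : Fin 2) (C : Equiv.Perm (Fin m) → Prop) (w : Fin m → ℝ)
    (k : ℕ) (A B R : Finset (Fin m)) : Prop :=
  ∀ b' : Bid m, (∀ a ∉ R, b'.val a = w a) → C b'.pref →
    StateAt (Function.update b i b') i j k A B R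

namespace Forces

variable {b : Fin 2 → Bid m} {i j : Fin 2} {C C' : Equiv.Perm (Fin m) → Prop} {w : Fin m → ℝ}
  {k : ℕ} {A B R : Finset (Fin m)} {g : Fin m}

theorem bval_eq {b' : Bid m} {S : Finset (Fin m)} (hS : Disjoint S R)
    (h : ∀ a ∉ R, b'.val a = w a) : bval b' S = ∑ a ∈ S, w a :=
  sum_congr rfl fun a ha => h a (disjoint_left.1 hS ha)

theorem agree_of_update {f w : Fin m → ℝ} {c : ℝ} (hg : g ∈ R)
    (h : ∀ a ∉ R.erase g, f a = Function.update w g c a) : ∀ a ∉ R, f a = w a := by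
  intro a ha
  have hag : a ≠ g := fun h => ha (h ▸ hg)
  rw [h a fun h => ha (mem_of_mem_erase h), Function.update_of_ne hag]

theorem step_left (h : Forces b i j C w k A B R) (hp : IsPartial k A B R) (hij : i ≠ j)
    (hg : g ∈ R) (c : ℝ) (hC : ∀ p, C' p → C p ∧ ∀ x ∈ R, p g ≤ p x)
    (hj : ¬ ∑ a ∈ B, (b j).val a < ∑ a ∈ A, (b j).val a)
    (hi : ∑ a ∈ A, w a < ∑ a ∈ B, w a ∨ i = 0)
    (hmut : ¬ (∑ a ∈ A, w a + c < ∑ a ∈ B, w a ∧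
      ∑ a ∈ B, (b j).val a < ∑ a ∈ A, (b j).val a + (b j).val g)) :
    Forces b i j C' (Function.update w g c) (k + 1) (insert g A) B (R.erase g) := by
  intro b' hb' hC'
  have hag := agree_of_update hg hb'
  have hA' : bval b' (insert g A) = ∑ a ∈ A, w a + c := by
    rw [bval_eq (hp.insert_left hg).disjoint_left hb', hp.sum_insert_update_left hg]
  refine (h b' hag (hC _ hC').1).succ hij hg ?_ ?_ ?_ ?_
  · simpa using (hC _ hC').2
  · simpa [hij.symm, bval] using hj
  · simpa [bval_eq hp.disjoint_left hag, bval_eq hp.disjoint_right hag] using hi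
  · rw [Function.update_self, hA', bval_eq hp.disjoint_right hag, Function.update_of_ne hij.symm]
    simpa only [bval, hp.sum_insert_left hg] using hmut

theorem step_left_swap (h : Forces b i j C w k A B R) (hp : IsPartial k A B R) (hij : i ≠ j)
    (hg : g ∈ R) (hC : ∀ p, C' p → C p ∧ ∀ x ∈ R, p g ≤ p x)
    (hj : ¬ ∑ a ∈ B, (b j).val a < ∑ a ∈ A, (b j).val a)
    (hi : ∑ a ∈ A, w a < ∑ a ∈ B, w a ∨ i = 0)
    (h₁ : ∑ a ∈ A, w a + w g < ∑ a ∈ B, w a)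
    (h₂ : ∑ a ∈ B, (b j).val a < ∑ a ∈ A, (b j).val a + (b j).val g) :
    Forces b i j C' w (k + 1) B (insert g A) (R.erase g) := by
  intro b' hb' hC'
  have hag : ∀ a ∉ R, b'.val a = w a := fun a ha => hb' a fun h => ha (mem_of_mem_erase h)
  refine (h b' hag (hC _ hC').1).succ_swap hij hg ?_ ?_ ?_ ?_ ?_
  · simpa using (hC _ hC').2
  · simpa [hij.symm, bval] using hj
  · simpa [bval_eq hp.disjoint_left hag, bval_eq hp.disjoint_right hag] using hi
  · rwa [Function.update_self, bval_eq (hp.insert_left hg).disjoint_left hb',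
      bval_eq hp.disjoint_right hag, hp.sum_insert_left hg]
  · rw [Function.update_of_ne hij.symm]
    simpa only [bval, hp.sum_insert_left hg] using h₂

theorem step_right (h : Forces b i j C w k A B R) (hp : IsPartial k A B R) (hij : i ≠ j)
    (hg : g ∈ R) (c : ℝ) (hC : ∀ p, C' p → C p) (hmin : ∀ x ∈ R, (b j).pref g ≤ (b j).pref x)
    (hi : ¬ ∑ a ∈ A, w a < ∑ a ∈ B, w a)
    (hj : ∑ a ∈ B, (b j).val a < ∑ a ∈ A, (b j).val a ∨ j = 0)
    (hmut : ¬ (∑ a ∈ A, w a < ∑ a ∈ B, w a + c ∧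
      ∑ a ∈ B, (b j).val a + (b j).val g < ∑ a ∈ A, (b j).val a)) :
    Forces b i j C' (Function.update w g c) (k + 1) A (insert g B) (R.erase g) := by
  intro b' hb' hC'
  have hag := agree_of_update hg hb'
  have hB' : bval b' (insert g B) = ∑ a ∈ B, w a + c := by
    rw [bval_eq (hp.insert_right hg).disjoint_right hb', hp.sum_insert_update_right hg]
  refine ((h b' hag (hC _ hC')).comm.succ hij.symm hg ?_ ?_ ?_ ?_).comm
  · simpa [hij.symm] using hmin
  · simpa [bval_eq hp.disjoint_left hag, bval_eq hp.disjoint_right hag] using hi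
  · simpa [hij.symm, bval] using hj
  · rw [Function.update_self, hB', bval_eq hp.disjoint_left hag, Function.update_of_ne hij.symm]
    simpa only [bval, hp.sum_insert_right hg, and_comm] using hmut

theorem step_right_swap (h : Forces b i j C w k A B R) (hp : IsPartial k A B R) (hij : i ≠ j)
    (hg : g ∈ R) (hC : ∀ p, C' p → C p) (hmin : ∀ x ∈ R, (b j).pref g ≤ (b j).pref x)
    (hi : ¬ ∑ a ∈ A, w a < ∑ a ∈ B, w a)
    (hj : ∑ a ∈ B, (b j).val a < ∑ a ∈ A, (b j).val a ∨ j = 0)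
    (h₁ : ∑ a ∈ A, w a < ∑ a ∈ B, w a + w g)
    (h₂ : ∑ a ∈ B, (b j).val a + (b j).val g < ∑ a ∈ A, (b j).val a) :
    Forces b i j C' w (k + 1) (insert g B) A (R.erase g) := by
  intro b' hb' hC'
  have hag : ∀ a ∉ R, b'.val a = w a := fun a ha => hb' a fun h => ha (mem_of_mem_erase h)
  refine ((h b' hag (hC _ hC')).comm.succ_swap hij.symm hg ?_ ?_ ?_ ?_ ?_).comm
  · simpa [hij.symm] using hmin
  · simpa [bval_eq hp.disjoint_left hag, bval_eq hp.disjoint_right hag] using hi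
  · simpa [hij.symm, bval] using hj
  · rw [Function.update_of_ne hij.symm]
    simpa only [bval, hp.sum_insert_right hg] using h₂
  · rwa [Function.update_self, bval_eq (hp.insert_right hg).disjoint_right hb',
      bval_eq hp.disjoint_left hag, hp.sum_insert_right hg]

end Forces

/-- Processing the goods of `R` in the order `p`, the total `u`-value of the goods of `T` so far,
plus the offset `D`, never exceeds that of the other goods when a good of `T` comes up. -/
def Secures (u : Fin m → ℝ) (p : Equiv.Perm (Fin m)) (D : ℝ) (T R : Finset (Fin m)) : Prop :=
  ∀ x ∈ T, D + ∑ a ∈ T with p a < p x, u a ≤ ∑ a ∈ R \ T with p a < p x, u a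

namespace Secures

variable {u : Fin m → ℝ} {p : Equiv.Perm (Fin m)} {D : ℝ} {T R : Finset (Fin m)} {g : Fin m}

theorem erase_mem (h : Secures u p D T R) (hg : g ∈ T) (hmin : ∀ x ∈ T, p g ≤ p x) :
    Secures u p (D + u g) (T.erase g) (R.erase g) := by
  intro x hx
  have hxT := mem_of_mem_erase hx
  have hlt : p g < p x := lt_of_le_of_ne (hmin x hxT) fun h => (ne_of_mem_erase hx)
    (p.injective h).symm
  have := h x hxT
  have hR : R.erase g \ T.erase g = R \ T := by
    ext a
    simp only [mem_sdiff, mem_erase]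
    by_cases ha : a = g
    · simp [ha, hg]
    · simp [ha]
  rw [hR, filter_erase]
  have hs := sum_erase_add (T.filter fun a => p a < p x) u (mem_filter.2 ⟨hg, hlt⟩)
  linarith

theorem erase_notMem_iff (hg : g ∈ R) (hT : T ⊆ R.erase g) (hmin : ∀ x ∈ R, p g ≤ p x) :
    Secures u p (D - u g) T (R.erase g) ↔ Secures u p D T R := by
  refine forall₂_congr fun x hx => ?_
  have hxR := hT hx
  have hlt : p g < p x := lt_of_le_of_ne (hmin x (mem_of_mem_erase hxR)) fun h =>
    (ne_of_mem_erase hxR) (p.injective h).symm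
  have hgT : g ∉ T := fun h => notMem_erase g R (hT h)
  rw [erase_sdiff_comm, filter_erase]
  have hs := sum_erase_add ((R \ T).filter fun a => p a < p x) u
    (mem_filter.2 ⟨mem_sdiff.2 ⟨hg, hgT⟩, hlt⟩)
  constructor <;> intro <;> linarith

theorem notMem (h : Secures u p D T R) (hD : 0 < D) (hTR : T ⊆ R)
    (hmin : ∀ x ∈ R, p g ≤ p x) : g ∉ T := by
  intro hgT
  have := h g hgT
  rw [filter_false_of_mem fun a ha => (hmin a (hTR ha)).not_gt,
    filter_false_of_mem fun a ha => (hmin a (mem_sdiff.1 ha).1).not_gt] at this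
  simp only [sum_empty] at this
  linarith

theorem empty : Secures u p D ∅ R := fun _ hx => absurd hx (notMem_empty _)

end Secures

theorem exists_first (p : Equiv.Perm (Fin m)) {R : Finset (Fin m)} (hR : R.Nonempty) :
    ∃ g ∈ R, ∀ x ∈ R, p g ≤ p x :=
  R.exists_min_image p hR

theorem update_nonneg {w : Fin m → ℝ} (hw : ∀ a, 0 ≤ w a) {c : ℝ} (hc : 0 ≤ c) (g : Fin m) :
    ∀ a, 0 ≤ Function.update w g c a := by
  intro a
  rcases eq_or_ne a g with rfl | h
  · simpa
  · simpa [h] using hw a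

/-- If agent `i` can steer the run to a state in which she picks next unless `j` envies her, she
can go on to obtain every good of a set `T` that is secured against `j`'s preference list. -/
theorem Forces.exists_superset {b : Fin 2 → Bid m} {i j : Fin 2} (hij : i ≠ j)
    {q : Equiv.Perm (Fin m)} {w : Fin m → ℝ} {k : ℕ} {A B R T : Finset (Fin m)}
    (h : Forces b i j (· = q) w k A B R) (hp : IsPartial k A B R) (hw : ∀ a, 0 ≤ w a)
    (hpos : ∑ a ∈ B, (b j).val a < ∑ a ∈ A, (b j).val a → ¬ ∑ a ∈ A, w a < ∑ a ∈ B, w a)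
    (hneg : ¬ ∑ a ∈ B, (b j).val a < ∑ a ∈ A, (b j).val a →
      ∑ a ∈ A, w a < ∑ a ∈ B, w a ∨ i = 0)
    (hTR : T ⊆ R)
    (hq : ∀ x ∈ T, ∀ y ∈ R, y ≠ x → (y ∉ T ∨ (b j).pref x < (b j).pref y) → q x < q y)
    (hT : Secures (b j).val (b j).pref
      (∑ a ∈ A, (b j).val a - ∑ a ∈ B, (b j).val a) T R) :
    ∃ b' : Bid m, A ∪ T ⊆ PreferredItemECE (Function.update b i b') i := by
  induction hn : #R generalizing w k A B R T with
  | zero =>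
    have hR : R = ∅ := card_eq_zero.1 hn
    have hs := h ⟨w, hw, q⟩ (fun _ _ => rfl) rfl
    refine ⟨⟨w, hw, q⟩, ?_⟩
    rw [(hs.preferredItemECE_eq hp hR).1]
    exact union_subset subset_rfl (hTR.trans (hR ▸ empty_subset _))
  | succ n ih =>
    have hne : R.Nonempty := card_pos.1 (by omega)
    by_cases hD : ∑ a ∈ B, (b j).val a < ∑ a ∈ A, (b j).val a
    · obtain ⟨g, hg, hmin⟩ := exists_first (b j).pref hne
      have hgT : g ∉ T := hT.notMem (by linarith) hTR hmin
      have hTR' : T ⊆ R.erase g := subset_erase.2 ⟨hTR, hgT⟩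
      obtain ⟨c, hc, hc₁, hc₂⟩ : ∃ c : ℝ, 0 ≤ c ∧
          (∑ a ∈ B, (b j).val a + (b j).val g < ∑ a ∈ A, (b j).val a → c = 0) ∧
          (¬ ∑ a ∈ B, (b j).val a + (b j).val g < ∑ a ∈ A, (b j).val a →
            ∑ a ∈ A, w a < ∑ a ∈ B, w a + c) := by
        by_cases hD' : ∑ a ∈ B, (b j).val a + (b j).val g < ∑ a ∈ A, (b j).val a
        · exact ⟨0, le_rfl, fun _ => rfl, fun h => absurd hD' h⟩
        · refine ⟨∑ a ∈ A, w a - ∑ a ∈ B, w a + 1, ?_, fun h => absurd h hD', fun _ => ?_⟩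
          · linarith [hpos hD]
          · linarith
      have hpos' : ∑ a ∈ B, (b j).val a + (b j).val g < ∑ a ∈ A, (b j).val a →
          ¬ ∑ a ∈ A, w a < ∑ a ∈ B, w a + c := fun h => by
        rw [hc₁ h, add_zero]
        exact hpos hD
      have hstep := h.step_right hp hij hg c (C' := (· = q)) (fun _ h => h) hmin (hpos hD)
        (Or.inl hD) fun h => hpos' h.2 h.1
      have hp' := hp.insert_right hg
      refine ih hstep hp' (update_nonneg hw hc g) ?_ ?_ hTR'
        (fun x hx y hy => hq x hx y (mem_of_mem_erase hy)) ?_ ?_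
      · rwa [hp.sum_update_left hg, hp.sum_insert_update_right hg, hp.sum_insert_right hg]
      · rw [hp.sum_update_left hg, hp.sum_insert_update_right hg, hp.sum_insert_right hg]
        exact fun h => Or.inl (hc₂ h)
      · rw [hp.sum_insert_right hg, ← sub_sub]
        exact (Secures.erase_notMem_iff hg hTR' hmin).2 hT
      · rw [card_erase_of_mem hg, hn, Nat.add_sub_cancel]
    · obtain ⟨g, hg, hqmin⟩ := exists_first q hne
      obtain ⟨c, hc, hc₁, hc₂⟩ : ∃ c : ℝ, 0 ≤ c ∧
          (∑ a ∈ B, (b j).val a < ∑ a ∈ A, (b j).val a + (b j).val g →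
            ¬ ∑ a ∈ A, w a + c < ∑ a ∈ B, w a) ∧
          (¬ ∑ a ∈ B, (b j).val a < ∑ a ∈ A, (b j).val a + (b j).val g → c = 0) := by
        by_cases hD' : ∑ a ∈ B, (b j).val a < ∑ a ∈ A, (b j).val a + (b j).val g
        · refine ⟨max 0 (∑ a ∈ B, w a - ∑ a ∈ A, w a), le_max_left _ _, fun _ => ?_,
            fun h => absurd hD' h⟩
          linarith [le_max_right 0 (∑ a ∈ B, w a - ∑ a ∈ A, w a)]
        · exact ⟨0, le_rfl, fun h => absurd h hD', fun _ => rfl⟩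
      have hstep := h.step_left hp hij hg c (C' := (· = q)) (fun _ h => ⟨h, h ▸ hqmin⟩) hD (hneg hD)
        fun h => hc₁ h.2 h.1
      obtain ⟨b', hb'⟩ := ih (T := T.erase g) hstep (hp.insert_left hg) (update_nonneg hw hc g)
        (by rwa [hp.sum_update_right hg, hp.sum_insert_update_left hg, hp.sum_insert_left hg])
        (by
          rw [hp.sum_update_right hg, hp.sum_insert_update_left hg, hp.sum_insert_left hg]
          intro h
          rw [hc₂ h, add_zero]
          exact hneg hD)
        (erase_subset_erase g hTR)
        (fun x hx y hy hyx hxy => hq x (mem_of_mem_erase hx) y (mem_of_mem_erase hy) hyx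
          (hxy.imp_left fun h hyT => h (mem_erase.2 ⟨ne_of_mem_erase hy, hyT⟩)))
        (by
          by_cases hgT : g ∈ T
          · rw [hp.sum_insert_left hg, add_sub_right_comm]
            refine hT.erase_mem hgT fun x hx => ?_
            by_contra! hlt
            exact (hqmin x (hTR hx)).not_gt
              (hq x hx g hg (fun h => (h ▸ hlt).false) (Or.inr hlt))
          · have hTe : T = ∅ := by
              refine eq_empty_of_forall_notMem fun x hx => ?_
              exact (hqmin x (hTR hx)).not_gt
                (hq x hx g hg (fun h => hgT (h ▸ hx)) (Or.inl hgT))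
            rw [hTe]
            exact Secures.empty)
        (by rw [card_erase_of_mem hg, hn, Nat.add_sub_cancel])
      refine ⟨b', Subset.trans (fun x hx => ?_) hb'⟩
      simp only [mem_union, mem_insert, mem_erase] at hx ⊢
      tauto

/-- The preference list `q` ranks the goods outside `R` above the same goods as `p` does. -/
def Compatible (p : Equiv.Perm (Fin m)) (R : Finset (Fin m)) (q : Equiv.Perm (Fin m)) : Prop :=
  ∀ a ∉ R, ∀ x, p a < p x → q a < q x

theorem Compatible.of_erase {p q : Equiv.Perm (Fin m)} {R : Finset (Fin m)} {g : Fin m}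
    (h : Compatible p (R.erase g) q) : Compatible p R q :=
  fun a ha => h a fun h => ha (mem_of_mem_erase h)

theorem Compatible.first {p q : Equiv.Perm (Fin m)} {R : Finset (Fin m)} {g : Fin m}
    (h : Compatible p (R.erase g) q) (hmin : ∀ x ∈ R, p g ≤ p x) : ∀ x ∈ R, q g ≤ q x := by
  intro x hx
  rcases (hmin x hx).eq_or_lt with h' | h'
  · rw [p.injective h']
  · exact (h g (notMem_erase _ _) x h').le

theorem exists_compatible (p r : Equiv.Perm (Fin m)) {R T : Finset (Fin m)} (hTR : T ⊆ R) :
    ∃ q, Compatible p R q ∧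
      ∀ x ∈ T, ∀ y ∈ R, y ≠ x → (y ∉ T ∨ r x < r y) → q x < q y := by
  obtain ⟨q, hq⟩ := exists_perm_lt_of_key_lt fun a : Fin m =>
    if a ∉ R then (p a : ℕ) else if a ∈ T then m + r a else 2 * m + r a
  refine ⟨q, fun a ha x hax => hq _ _ ?_, fun x hx y hy _ hxy => hq _ _ ?_⟩
  · have := (p a).2
    have : (p a : ℕ) < p x := hax
    rw [if_pos ha]
    split_ifs <;> omega
  · have := (r x).2
    rw [if_neg (not_not.2 (hTR hx)), if_pos hx, if_neg (not_not.2 hy)]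
    rcases hxy with h | h
    · rw [if_neg h]
      omega
    · have : (r x : ℕ) < r y := h
      split_ifs <;> omega

section Deviation

variable {b : Fin 2 → Bid m} {i j : Fin 2} {p : Equiv.Perm (Fin m)} {w v : Fin m → ℝ}
  {k : ℕ} {A B R T : Finset (Fin m)} {V : ℝ}

theorem Forces.value_le (h : Forces b i j (Compatible p R) w k A B R) (hij : i ≠ j)
    (hp : IsPartial k A B R) (hw : ∀ a, 0 ≤ w a) (hv : ∀ a, 0 ≤ v a)
    (hV : ∀ b', value v (PreferredItemECE (Function.update b i b') i) ≤ V)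
    (hpos : ∑ a ∈ B, (b j).val a < ∑ a ∈ A, (b j).val a → ¬ ∑ a ∈ A, w a < ∑ a ∈ B, w a)
    (hneg : ¬ ∑ a ∈ B, (b j).val a < ∑ a ∈ A, (b j).val a →
      ∑ a ∈ A, w a < ∑ a ∈ B, w a ∨ i = 0)
    (hTR : T ⊆ R)
    (hT : Secures (b j).val (b j).pref
      (∑ a ∈ A, (b j).val a - ∑ a ∈ B, (b j).val a) T R) :
    ∑ a ∈ A, v a + ∑ a ∈ T, v a ≤ V := by
  obtain ⟨q, hq, hqT⟩ := exists_compatible p (b j).pref hTR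
  have h' : Forces b i j (· = q) w k A B R := fun b' hb' hb'q => h b' hb' (hb'q ▸ hq)
  obtain ⟨b', hb'⟩ := h'.exists_superset hij hp hw hpos hneg hTR hqT hT
  rw [← sum_union (hp.disjoint_left.mono_right hTR)]
  exact (sum_le_sum_of_subset_of_nonneg hb' fun a _ _ => hv a).trans (hV b')

/-- Agent `i` can attain value at most `V`; yet, from a state in which she holds `A` and the other
agent, holding `B`, picks next, she can secure `A` together with any secured set of goods. -/
def Bounds (o : Bid m) (v : Fin m → ℝ) (V : ℝ) (A B R : Finset (Fin m)) : Prop :=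
  (R = ∅ → ∑ a ∈ A, v a ≤ V) ∧
  ∀ g ∈ R, (∀ x ∈ R, o.pref g ≤ o.pref x) → ∀ T ⊆ R.erase g,
    Secures o.val o.pref (∑ a ∈ A, o.val a - ∑ a ∈ B, o.val a - o.val g) T (R.erase g) →
    ∑ a ∈ A, v a + ∑ a ∈ T, v a ≤ V

theorem Forces.bounds_of_envied (h : Forces b i j (Compatible p R) w k A B R) (hij : i ≠ j)
    (hp : IsPartial k A B R) (hw : ∀ a, 0 ≤ w a) (hv : ∀ a, 0 ≤ v a)
    (hV : ∀ b', value v (PreferredItemECE (Function.update b i b') i) ≤ V)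
    (hD : ∑ a ∈ B, (b j).val a < ∑ a ∈ A, (b j).val a)
    (hi : ¬ ∑ a ∈ A, w a < ∑ a ∈ B, w a) : Bounds (b j) v V A B R := by
  refine ⟨fun hR => ?_, fun g hg hmin T hT hs => ?_⟩
  · simpa using h.value_le hij hp hw hv hV (fun _ => hi) (fun h => absurd hD h)
      (empty_subset _) Secures.empty
  · exact h.value_le hij hp hw hv hV (fun _ => hi) (fun h => absurd hD h)
      (hT.trans (erase_subset _ _)) ((Secures.erase_notMem_iff hg hT hmin).1 hs)

theorem Forces.value_le_of_first (h : Forces b i j (Compatible p R) w k A B R) (hij : i ≠ j)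
    (hp : IsPartial k A B R) (hw : ∀ a, 0 ≤ w a) (hv : ∀ a, 0 ≤ v a)
    (hV : ∀ b', value v (PreferredItemECE (Function.update b i b') i) ≤ V) (hj : j = 0)
    (hD : ¬ ∑ a ∈ B, (b j).val a < ∑ a ∈ A, (b j).val a)
    (hi : ¬ ∑ a ∈ A, w a < ∑ a ∈ B, w a) {g : Fin m} (hg : g ∈ R)
    (hmin : ∀ x ∈ R, (b j).pref g ≤ (b j).pref x) (hT : T ⊆ R.erase g)
    (hs : Secures (b j).val (b j).pref
      (∑ a ∈ A, (b j).val a - ∑ a ∈ B, (b j).val a - (b j).val g) T (R.erase g)) :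
    ∑ a ∈ A, v a + ∑ a ∈ T, v a ≤ V := by
  have hu := (b j).nonneg g
  have hc : 0 ≤ ∑ a ∈ A, w a - ∑ a ∈ B, w a + 1 := by linarith
  have hstep := h.step_right hp hij hg (∑ a ∈ A, w a - ∑ a ∈ B, w a + 1)
    (C' := Compatible p (R.erase g)) (fun _ => Compatible.of_erase) hmin hi (Or.inr hj)
    fun h => by linarith [h.2]
  refine hstep.value_le hij (hp.insert_right hg) (update_nonneg hw hc g) hv hV ?_ ?_ hT ?_
  · rw [hp.sum_insert_right hg]
    intro h
    linarith
  · rw [hp.sum_update_left hg, hp.sum_insert_update_right hg]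
    exact fun _ => Or.inl (by linarith)
  · rwa [hp.sum_insert_right hg, ← sub_sub]

theorem Bounds.two_mul_ge {o : Bid m} (h₁ : Bounds o v V A B R) (h₂ : Bounds o v V B A R)
    (hp : IsPartial k A B R) {g : Fin m} (hg : g ∈ R) (hmin : ∀ x ∈ R, o.pref g ≤ o.pref x) :
    ∑ a, v a - v g ≤ 2 * V := by
  obtain ⟨Y, hY, hY₁, hY₂⟩ := exists_greedy_split o.val o.pref
    (∑ a ∈ A, o.val a - ∑ a ∈ B, o.val a - o.val g) (R.erase g)
  have ha := h₁.2 g hg hmin Y hY hY₁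
  have hb := h₂.2 g hg hmin (R.erase g \ Y) sdiff_subset fun x hx => by
    rw [Finset.sdiff_sdiff_eq_self hY]
    linarith [hY₂ x hx, o.nonneg g]
  have hsplit := sum_sdiff (f := v) hY
  have herase := sum_erase_add R v hg
  have := hp.sum v
  linarith

end Deviation

theorem EF1From_of_forall_le {v : Fin m → ℝ} {P : Fin 2 → Finset (Fin m)} {i j : Fin 2}
    (hij : i ≠ j) (hv : ∀ a, 0 ≤ v a)
    (h : (P j).Nonempty → ∃ g ∈ P j, ∑ a ∈ P j, v a - v g ≤ ∑ a ∈ P i, v a) :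
    EF1From 1 v P i := by
  intro l hl
  have hcase : l = i ∨ l = j := by omega
  rcases hcase with rfl | rfl
  · obtain ⟨g, hg⟩ := hl
    refine ⟨g, hg, ?_⟩
    rw [one_mul]
    exact sum_le_sum_of_subset_of_nonneg (erase_subset _ _) fun a _ _ => hv a
  · obtain ⟨g, hg, hle⟩ := h hl
    refine ⟨g, hg, ?_⟩
    rw [one_mul, value, value, sum_erase_eq_sub hg]
    exact hle

section Run

variable {b : Fin 2 → Bid m} {i j : Fin 2} {p : Equiv.Perm (Fin m)} {w v : Fin m → ℝ}
  {k : ℕ} {A B R : Finset (Fin m)} {V : ℝ}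

/-- Neither agent envies the other, and `Bounds` holds for agent `i` with the bundles exchanged. -/
def SwapBounded (o : Bid m) (w v : Fin m → ℝ) (V : ℝ) (A B R : Finset (Fin m)) : Prop :=
  ¬ ∑ a ∈ A, w a < ∑ a ∈ B, w a ∧ ¬ ∑ a ∈ B, o.val a < ∑ a ∈ A, o.val a ∧ Bounds o v V B A R

/-- A state of the run that persists when agent `i` modifies the part of her bid that has not yet
been used, and in which the two agents do not envy each other mutually. -/
structure Reached (b : Fin 2 → Bid m) (i j : Fin 2) (p : Equiv.Perm (Fin m)) (w : Fin m → ℝ)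
    (k : ℕ) (A B R : Finset (Fin m)) : Prop where
  isPartial : IsPartial k A B R
  forces : Forces b i j (Compatible p R) w k A B R
  not_mutual : ¬ (∑ a ∈ A, w a < ∑ a ∈ B, w a ∧ ∑ a ∈ B, (b j).val a < ∑ a ∈ A, (b j).val a)

namespace Reached

theorem zero (b : Fin 2 → Bid m) (i j : Fin 2) (p : Equiv.Perm (Fin m)) (w : Fin m → ℝ) :
    Reached b i j p w 0 ∅ ∅ univ :=
  ⟨IsPartial.zero, fun _ _ _ => StateAt.zero _ _ _, by simp⟩

theorem next_left (h : Reached b i j p w k A B R) (hij : i ≠ j) (hw : ∀ a, 0 ≤ w a)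
    (hv : ∀ a, 0 ≤ v a)
    (hV : ∀ b', value v (PreferredItemECE (Function.update b i b') i) ≤ V) (hR : R.Nonempty)
    (hj : ¬ ∑ a ∈ B, (b j).val a < ∑ a ∈ A, (b j).val a)
    (hi : ∑ a ∈ A, w a < ∑ a ∈ B, w a ∨ i = 0) :
    ∃ A' B' R', Reached b i j p w (k + 1) A' B' R' ∧
      (B ⊆ B' ∨ SwapBounded (b j) w v V A' B' R') := by
  obtain ⟨hp, hf, -⟩ := h
  obtain ⟨g, hg, hmin⟩ := exists_first p hR
  have hC : ∀ q, Compatible p (R.erase g) q → Compatible p R q ∧ ∀ x ∈ R, q g ≤ q x :=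
    fun q hq => ⟨hq.of_erase, hq.first hmin⟩
  have hp' := hp.insert_left hg
  by_cases hmut : ∑ a ∈ A, w a + w g < ∑ a ∈ B, w a ∧
      ∑ a ∈ B, (b j).val a < ∑ a ∈ A, (b j).val a + (b j).val g
  · have hc : 0 ≤ ∑ a ∈ B, w a - ∑ a ∈ A, w a := by linarith [hmut.1, hw g]
    have hb := (hf.step_left hp hij hg _ hC hj hi fun h => by linarith [h.1]).bounds_of_envied hij
      hp' (update_nonneg hw hc g) hv hV (by rw [hp.sum_insert_left hg]; exact hmut.2)
      (by rw [hp.sum_insert_update_left hg, hp.sum_update_right hg]; linarith)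
    have hA := hp.sum_insert_left hg w
    have hA' := hp.sum_insert_left hg (b j).val
    refine ⟨_, _, _, ⟨hp'.comm, hf.step_left_swap hp hij hg hC hj hi hmut.1 hmut.2, ?_⟩,
      Or.inr ⟨?_, ?_, hb⟩⟩
    · rintro ⟨h, -⟩
      linarith [hmut.1]
    · linarith [hmut.1]
    · linarith [hmut.2]
  · refine ⟨_, _, _, ⟨hp', ?_, ?_⟩, Or.inl subset_rfl⟩
    · simpa using hf.step_left hp hij hg (w g) hC hj hi hmut
    · rwa [hp.sum_insert_left hg, hp.sum_insert_left hg]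

theorem next_right (h : Reached b i j p w k A B R) (hij : i ≠ j) (hw : ∀ a, 0 ≤ w a)
    (hv : ∀ a, 0 ≤ v a)
    (hV : ∀ b', value v (PreferredItemECE (Function.update b i b') i) ≤ V) (hR : R.Nonempty)
    (hi : ¬ ∑ a ∈ A, w a < ∑ a ∈ B, w a)
    (hj : ∑ a ∈ B, (b j).val a < ∑ a ∈ A, (b j).val a ∨ j = 0) :
    ∃ A' B' R', Reached b i j p w (k + 1) A' B' R' ∧
      (B ⊆ B' ∨ SwapBounded (b j) w v V A' B' R') := by
  obtain ⟨hp, hf, -⟩ := h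
  obtain ⟨g, hg, hmin⟩ := exists_first (b j).pref hR
  have hC : ∀ q, Compatible p (R.erase g) q → Compatible p R q := fun _ => Compatible.of_erase
  have hp' := hp.insert_right hg
  by_cases hmut : ∑ a ∈ A, w a < ∑ a ∈ B, w a + w g ∧
      ∑ a ∈ B, (b j).val a + (b j).val g < ∑ a ∈ A, (b j).val a
  · have hb := (hf.step_right hp hij hg 0 hC hmin hi hj fun h =>
      hi (by linarith [h.1])).bounds_of_envied hij hp' (update_nonneg hw le_rfl g) hv hV
      (by rw [hp.sum_insert_right hg]; exact hmut.2)
      (by rw [hp.sum_insert_update_right hg, hp.sum_update_left hg]; linarith)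
    have hB := hp.sum_insert_right hg w
    have hB' := hp.sum_insert_right hg (b j).val
    refine ⟨_, _, _, ⟨hp'.comm, hf.step_right_swap hp hij hg hC hmin hi hj hmut.1 hmut.2, ?_⟩,
      Or.inr ⟨?_, ?_, hb⟩⟩
    · rintro ⟨h, -⟩
      linarith [hmut.1]
    · linarith [hmut.1]
    · linarith [hmut.2]
  · refine ⟨_, _, _, ⟨hp', ?_, ?_⟩, Or.inl (subset_insert _ _)⟩
    · simpa using hf.step_right hp hij hg (w g) hC hmin hi hj hmut
    · rwa [hp.sum_insert_right hg, hp.sum_insert_right hg]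

theorem next (h : Reached b i j p w k A B R) (hij : i ≠ j) (hw : ∀ a, 0 ≤ w a)
    (hv : ∀ a, 0 ≤ v a)
    (hV : ∀ b', value v (PreferredItemECE (Function.update b i b') i) ≤ V) (hR : R.Nonempty) :
    ∃ A' B' R', Reached b i j p w (k + 1) A' B' R' ∧
      (B ⊆ B' ∨ SwapBounded (b j) w v V A' B' R') := by
  have h0 : i = 0 ∨ j = 0 := by omega
  by_cases hi : ∑ a ∈ A, w a < ∑ a ∈ B, w a
  · exact h.next_left hij hw hv hV hR (fun hj => h.not_mutual ⟨hi, hj⟩) (Or.inl hi)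
  · by_cases hj : ∑ a ∈ B, (b j).val a < ∑ a ∈ A, (b j).val a
    · exact h.next_right hij hw hv hV hR hi (Or.inl hj)
    · rcases h0 with h0 | h0
      · exact h.next_left hij hw hv hV hR hj (Or.inr h0)
      · exact h.next_right hij hw hv hV hR hi (Or.inr h0)

theorem next_of_swapBounded (h : Reached b i j p w k A B R) (hs : SwapBounded (b j) w v V A B R)
    (hij : i ≠ j) (hw : ∀ a, 0 ≤ w a) (hv : ∀ a, 0 ≤ v a)
    (hV : ∀ b', value v (PreferredItemECE (Function.update b i b') i) ≤ V) (hR : R.Nonempty)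
    (hj : j = 0) :
    ∃ A' B' R', Reached b i j p w (k + 1) A' B' R' ∧ ∃ r ∈ B', ∑ a, v a - v r ≤ 2 * V := by
  obtain ⟨hp, hf, -⟩ := h
  obtain ⟨hi, hD, hB⟩ := hs
  obtain ⟨g, hg, hmin⟩ := exists_first (b j).pref hR
  have hD' : ¬ ∑ a ∈ B, (b j).val a + (b j).val g < ∑ a ∈ A, (b j).val a := by
    linarith [(b j).nonneg g]
  refine ⟨A, insert g B, R.erase g, ⟨hp.insert_right hg, ?_, ?_⟩, g, mem_insert_self _ _, ?_⟩
  · simpa using hf.step_right hp hij hg (w g) (C' := Compatible p (R.erase g))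
      (fun _ => Compatible.of_erase) hmin hi (Or.inr hj) fun h => hD' h.2
  · rw [hp.sum_insert_right hg (b j).val]
    exact fun h => hD' h.2
  · refine Bounds.two_mul_ge ⟨fun h => absurd h hR.ne_empty, fun x hx hx' T hT hT' => ?_⟩ hB hp
      hg hmin
    exact hf.value_le_of_first hij hp hw hv hV hj hD hi hx hx' hT hT'

theorem swapBounded_zero (hij : i ≠ j) (hw : ∀ a, 0 ≤ w a) (hv : ∀ a, 0 ≤ v a)
    (hV : ∀ b', value v (PreferredItemECE (Function.update b i b') i) ≤ V) (hj : j = 0) :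
    SwapBounded (b j) w v V ∅ ∅ univ := by
  obtain ⟨hp, hf, -⟩ := zero b i j 1 w
  refine ⟨lt_irrefl _, lt_irrefl _, fun _ => ?_, fun g hg hmin T hT hs => ?_⟩
  · exact (sum_nonneg fun a _ => hv a).trans (hV (b i))
  · exact hf.value_le_of_first hij hp hw hv hV hj (lt_irrefl _) (lt_irrefl _) hg hmin hT hs

theorem exists_of_le (b : Fin 2 → Bid m) (p : Equiv.Perm (Fin m)) (hij : i ≠ j)
    (hw : ∀ a, 0 ≤ w a) (hv : ∀ a, 0 ≤ v a)
    (hV : ∀ b', value v (PreferredItemECE (Function.update b i b') i) ≤ V) (hk : k ≤ m) :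
    ∃ A B R, Reached b i j p w k A B R ∧
      (j = 0 → SwapBounded (b j) w v V A B R ∨ ∃ r ∈ B, ∑ a, v a - v r ≤ 2 * V) := by
  induction k with
  | zero => exact ⟨_, _, _, zero b i j p w, fun hj => Or.inl (swapBounded_zero hij hw hv hV hj)⟩
  | succ k ih =>
    obtain ⟨A, B, R, h, hs⟩ := ih (by omega)
    have hR : R.Nonempty := card_pos.1 (by have := h.isPartial.card; omega)
    by_cases hF : j = 0 ∧ SwapBounded (b j) w v V A B R
    · obtain ⟨A', B', R', h', hr⟩ := h.next_of_swapBounded hF.2 hij hw hv hV hR hF.1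
      exact ⟨A', B', R', h', fun _ => Or.inr hr⟩
    · obtain ⟨A', B', R', h', hs'⟩ := h.next hij hw hv hV hR
      refine ⟨A', B', R', h', fun hj => ?_⟩
      rcases hs' with hs' | hs'
      · obtain ⟨r, hr, hle⟩ := (hs hj).resolve_left fun h => hF ⟨hj, h⟩
        exact Or.inr ⟨r, hs' hr, hle⟩
      · exact Or.inl hs'

end Reached

theorem sum_le_two_mul_of_first (hij : i ≠ j) (hi : i = 0) (hv : ∀ a, 0 ≤ v a)
    (hV : ∀ b', value v (PreferredItemECE (Function.update b i b') i) ≤ V) :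
    ∑ a, v a ≤ 2 * V := by
  obtain ⟨hp, hf, -⟩ := Reached.zero b i j 1 (b i).val
  obtain ⟨Y, hY, hY₁, hY₂⟩ := exists_greedy_split (b j).val (b j).pref 0 univ
  have hle := fun T (hT : Secures (b j).val (b j).pref 0 T univ) =>
    hf.value_le hij hp (b i).nonneg hv hV (fun h => absurd h (lt_irrefl _))
      (fun _ => Or.inr hi) (subset_univ T) (by simpa using hT)
  have ha := hle Y hY₁
  have hb := hle (univ \ Y) fun x hx => by
    rw [Finset.sdiff_sdiff_eq_self hY]
    linarith [hY₂ x hx]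
  have hsplit := sum_sdiff (f := v) hY
  simp only [sum_empty] at ha hb
  linarith

end Run

end ECE

/-- For any instance with exactly 2 agents whose true valuations are
additive, and any bid profile in which agent `i`'s bid is a best response to the other
agent's bid, the allocation produced by Preferred-Item-E-C-E is EF1 from agent `i`'s
perspective with respect to agent `i`'s true valuation. -/
theorem preferredItem_two_best_response_EF1 {m : ℕ} (v : Fin 2 → Fin m → ℝ)
    (hv : ∀ i g, 0 ≤ v i g) (b : Fin 2 → Bid m) (i : Fin 2)
    (hbr : BestResponse PreferredItemECE (v i) b i) :
    EF1From 1 (v i) (PreferredItemECE b) i := by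
  obtain ⟨j, hij⟩ : ∃ j, i ≠ j := ⟨i + 1, by omega⟩
  obtain ⟨A, B, R, h, hs⟩ := Reached.exists_of_le b (b i).pref hij (b i).nonneg (hv i) hbr le_rfl
  have hR : R = ∅ := card_eq_zero.1 (by have := h.isPartial.card; omega)
  have hst := h.forces (b i) (fun _ _ => rfl) fun _ _ _ h => h
  rw [Function.update_eq_self] at hst
  obtain ⟨hA, hB⟩ := hst.preferredItemECE_eq h.isPartial hR
  refine EF1From_of_forall_le hij (hv i) ?_
  have hsum := h.isPartial.sum (v i)
  rw [hR, sum_empty] at hsum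
  rw [hA, hB]
  rintro ⟨g, hg⟩
  have hvg := hv i g
  have h0 : i = 0 ∨ j = 0 := by omega
  rcases h0 with h0 | h0
  · have hle := sum_le_two_mul_of_first hij h0 (hv i) hbr
    rw [hA, value] at hle
    exact ⟨g, hg, by linarith⟩
  · rw [hA, value] at hs
    rcases hs h0 with ⟨-, -, hb, -⟩ | ⟨r, hr, hle⟩
    · exact ⟨g, hg, by linarith [hb hR]⟩
    · exact ⟨r, hr, by linarith⟩
end
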